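/- For every n ∈ {13, 14, 16, 17, 18, 19, 20} there exist a tree on n vertices with maximum degree 4 and a point set of n points such that the tree does not admit an L-shaped embedding in the point set. -/

import Mathlib

/-- A point set: finitely many points in the plane, no two of which share
an x-coordinate or a y-coordinate. -/
def IsPointSet (S : Finset (ℝ × ℝ)) : Prop :=
  ∀ p ∈ S, ∀ q ∈ S, p ≠ q → p.1 ≠ q.1 ∧ p.2 ≠ q.2

/-- The drawing of the edge `uv`: the union of the two axis-parallel segments
joining `φ u` and `φ v` through the corner point `c u v`. -/
def LDraw {α : Type*} (φ : α → ℝ × ℝ) (c : α → α → ℝ × ℝ) (u v : α) : Set (ℝ × ℝ) :=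
  segment ℝ (φ u) (c u v) ∪ segment ℝ (c u v) (φ v)

/-- `φ` together with the corner assignment `c` is an L-shaped embedding of the
graph `G` in the point set `S`:  `φ` is an injective map of the vertices into `S`,
every edge `uv` is drawn as an `L` whose corner is `((φ u).1, (φ v).2)` or
`((φ v).1, (φ u).2)`, and the drawings of two distinct edges intersect only in the
image `φ w` of a common endpoint `w` of the two edges. -/
def IsLEmbedding {α : Type*} (G : SimpleGraph α) (S : Finset (ℝ × ℝ))
    (φ : α → ℝ × ℝ) (c : α → α → ℝ × ℝ) : Prop :=
  Function.Injective φ ∧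
  (∀ v, φ v ∈ S) ∧
  (∀ u v, c u v = c v u) ∧
  (∀ u v, G.Adj u v → c u v = ((φ u).1, (φ v).2) ∨ c u v = ((φ v).1, (φ u).2)) ∧
  (∀ u v a b, G.Adj u v → G.Adj a b → s(u, v) ≠ s(a, b) →
    ∀ p ∈ LDraw φ c u v ∩ LDraw φ c a b,
      ∃ w, (w = u ∨ w = v) ∧ (w = a ∨ w = b) ∧ p = φ w)

/-- `G` admits an L-shaped embedding in the point set `S`. -/
def HasLEmbedding {α : Type*} (G : SimpleGraph α) (S : Finset (ℝ × ℝ)) : Prop :=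
  ∃ φ c, IsLEmbedding G S φ c

namespace LShape

/-- Evaluate `x` to a numeral before passing it on. -/
noncomputable def force {β : Type} (x : Nat) (k : Nat → β) : β :=
  Nat.rec (k 0) (fun m _ => k (Nat.succ m)) x

/-- `all` on lists, by the recursor. -/
noncomputable def lall {α : Type} (p : α → Bool) (l : List α) : Bool :=
  List.rec true (fun h _ ih => and (p h) ih) l

/-- `n`-th element with default. -/
noncomputable def nth {α : Type} (d : α) (l : List α) : Nat → α :=
  List.rec (fun _ => d) (fun h _ ih i => Nat.rec h (fun j _ => ih j) i) l

/-- Evaluate a list, element by element. -/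
noncomputable def forceList {α : Type} (fo : α → (α → Bool) → Bool) (l : List α) :
    (List α → Bool) → Bool :=
  List.rec (fun k => k []) (fun h _ ih k => fo h (fun h' => ih (fun t => k (h' :: t)))) l

/-- `y`-coordinate of the point with `x`-coordinate `p` (packed in base 32). -/
def yc (Y p : Nat) : Nat := Nat.land (Nat.shiftRight Y (Nat.mul 5 p)) 31

/-- `c` lies between `a` and `b`. -/
def btw (a b c : Nat) : Bool :=
  or (and (Nat.ble a c) (Nat.ble c b)) (and (Nat.ble b c) (Nat.ble c a))

/-- The horizontal part of the L `(p, q)` meets the vertical part of the L `(r, s)`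
in a point which is not in the point set. -/
def hit (Y p q r s : Nat) : Bool :=
  and (not (Nat.beq s p)) (and (btw p q s) (btw (yc Y r) (yc Y s) (yc Y p)))

/-- The L's `(p, q)` and `(r, s)` do not conflict. -/
def okc (Y p q r s : Nat) : Bool :=
  and (not (hit Y p q r s)) (not (hit Y r s p q))

/-- The number with bit `k` equal to `f k`, for `k < m`. -/
noncomputable def mk (f : Nat → Bool) (m : Nat) : Nat :=
  Nat.rec 0 (fun k ih => Nat.lor (cond (f k) (Nat.pow 2 k) 0) ih) m

/-- Concatenation of `m` blocks of `n` bits. -/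
noncomputable def grid (n : Nat) (g : Nat → Nat) (m : Nat) : Nat :=
  Nat.rec 0 (fun k ih => Nat.lor (Nat.shiftLeft (g k) (Nat.mul n k)) ih) m

/-- Mask of the L's whose first endpoint satisfies `f`. -/
noncomputable def rows (n : Nat) (f : Nat → Bool) : Nat :=
  force (Nat.pred (Nat.pow 2 n)) fun u => grid n (fun k => cond (f k) u 0) n

/-- Mask of the L's whose second endpoint satisfies `f`. -/
noncomputable def cols (n : Nat) (f : Nat → Bool) : Nat :=
  force (mk f n) fun u => grid n (fun _ => u) n

/-- Masks associated with a point `p`. -/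
structure PM where
  cle : Nat
  cge : Nat
  nc : Nat
  vc : Nat
  hc : Nat
  ryle : Nat
  ryge : Nat

noncomputable def pmOf (n Y p : Nat) : PM :=
  ⟨cols n (fun s => Nat.ble s p), cols n (fun s => Nat.ble p s),
    cols n (fun s => not (Nat.beq s p)),
    Nat.lor
      (Nat.land (rows n (fun r => Nat.ble (yc Y r) (yc Y p)))
        (cols n (fun s => Nat.ble (yc Y p) (yc Y s))))
      (Nat.land (rows n (fun r => Nat.ble (yc Y p) (yc Y r)))
        (cols n (fun s => Nat.ble (yc Y s) (yc Y p)))),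
    Nat.lor
      (Nat.land (rows n (fun r => Nat.blt r p)) (cols n (fun s => Nat.ble p s)))
      (Nat.land (rows n (fun r => Nat.blt p r)) (cols n (fun s => Nat.ble s p))),
    rows n (fun r => Nat.ble (yc Y r) (yc Y p)),
    rows n (fun r => Nat.ble (yc Y p) (yc Y r))⟩

noncomputable def forcePM (o : PM) (k : PM → Bool) : Bool :=
  PM.rec (fun a b c d e f g => force a fun a => force b fun b => force c fun c =>
    force d fun d => force e fun e => force f fun f => force g fun g =>
    k ⟨a, b, c, d, e, f, g⟩) o

/-- Make room for a 64 bit tag, which is a hash value of the state of the search: bit `b` is moved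
to `b + 64`. -/
def sh (x : Nat) : Nat := Nat.lor (Nat.shiftLeft x 64) 18446744073709551615

/-- Mask of the L's which do not conflict with the L `(p, q)`. -/
noncomputable def keepOf (n : Nat) (P Q : PM) : Nat :=
  sh (Nat.xor (Nat.pred (Nat.pow 2 (Nat.mul n n)))
    (Nat.lor
      (Nat.land P.vc (Nat.land P.nc (Nat.lor (Nat.land P.cge Q.cle) (Nat.land Q.cge P.cle))))
      (Nat.land Q.hc (Nat.lor (Nat.land P.ryge Q.ryle) (Nat.land Q.ryge P.ryle)))))

noncomputable def nincMask (n p : Nat) : Nat :=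
  sh (Nat.land (rows n (fun r => not (Nat.beq r p))) (cols n (fun s => not (Nat.beq s p))))

/-- An option to use a port: the bit of the L, the mask of nonconflicting L's, the mask of
L's not incident with the other endpoint, the other endpoint, and its port. -/
structure Opt where
  bit : Nat
  keep : Nat
  ninc : Nat
  q : Nat
  e : Nat
  tag : Nat

structure Port where
  mask : Nat
  opts : List Opt

noncomputable def forceOpt (o : Opt) (k : Opt → Bool) : Bool :=
  Opt.rec (fun b kp ni q e g => force b fun b => force kp fun kp => force ni fun ni =>
    force q fun q => force e fun e => force g fun g => k ⟨b, kp, ni, q, e, g⟩) o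

noncomputable def forcePort (o : Port) (k : Port → Bool) : Bool :=
  Port.rec (fun m os => force m fun m => forceList forceOpt os fun os => k ⟨m, os⟩) o

/-- The port `d` of `p` is on the side of `w`. -/
def side (Y d p w : Nat) : Bool :=
  match d with
  | 0 => Nat.blt p w
  | 1 => Nat.blt w p
  | 2 => Nat.blt (yc Y p) (yc Y w)
  | _ => Nat.blt (yc Y w) (yc Y p)

/-- First (horizontal) endpoint of the L leaving `p` through `d` towards `w`. -/
def fstE (d p w : Nat) : Nat := cond (Nat.blt d 2) p w
def sndE (d p w : Nat) : Nat := cond (Nat.blt d 2) w p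
def codeE (n d p w : Nat) : Nat := Nat.add (Nat.mul (fstE d p w) n) (sndE d p w)

/-- The port at `w` of the L leaving `p` through `d` towards `w`. -/
def entry (Y d p w : Nat) : Nat :=
  cond (Nat.blt d 2) (cond (Nat.blt (yc Y w) (yc Y p)) 2 3) (cond (Nat.blt w p) 0 1)

/-- Hash value of an L. -/
def tagOf (c : Nat) : Nat := Nat.mod (Nat.mul (Nat.succ c) 11400714819323198485) 18446744073709551616

noncomputable def optOf (n Y : Nat) (KL : List (List Nat)) (NL : List Nat) (d p w : Nat) : Opt :=
  ⟨Nat.pow 2 (Nat.add (codeE n d p w) 64), nth 0 (nth [] KL (fstE d p w)) (sndE d p w), nth 0 NL w, w,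
    entry Y d p w, tagOf (codeE n d p w)⟩

noncomputable def orBits (l : List Opt) : Nat :=
  List.rec 0 (fun o _ ih => Nat.lor o.bit ih) l

noncomputable def portWith (n Y : Nat) (KL : List (List Nat)) (NL : List Nat) (p d : Nat) : Port :=
  let os := ((List.range n).filter (side Y d p)).map (optOf n Y KL NL d p)
  ⟨orBits os, os⟩

noncomputable def tabWith (n Y : Nat) (KL : List (List Nat)) (NL : List Nat) : List (List Port) :=
  (List.range n).map fun p => [0, 1, 2, 3].map (portWith n Y KL NL p)

noncomputable def pmList (n Y : Nat) : List PM := (List.range n).map (pmOf n Y)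

noncomputable def keepList (n : Nat) (L : List PM) : List (List Nat) :=
  L.map fun P => L.map (keepOf n P)

noncomputable def nincList (n : Nat) : List Nat := (List.range n).map (nincMask n)

/-- Call `k` with the evaluated table. -/
noncomputable def withTab (n Y : Nat) (k : List (List Port) → Bool) : Bool :=
  forceList forcePM (pmList n Y) fun L =>
  forceList (forceList force) (keepList n L) fun KL =>
  forceList force (nincList n) fun NL =>
  forceList (forceList forcePort) (tabWith n Y KL NL) k

def nz (x : Nat) : Bool := not (Nat.beq x 0)

noncomputable def allNZ (A : Nat) (ts : List Port) : Bool :=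
  lall (fun t => nz (Nat.land A t.mask)) ts

/-- Find a port with at most one option, and call `ks` with it and the other ports;
if there is none, return `kn`. -/
noncomputable def selK (A : Nat) (kn : Bool) (ts : List Port) : (Port → List Port → Bool) → Bool :=
  List.rec (fun _ => kn) (fun t ts ih ks =>
    cond (Nat.beq (Nat.land (Nat.land A t.mask) (Nat.sub (Nat.land A t.mask) 1)) 0) (ks t ts)
      (ih fun u r => ks u (t :: r))) ts

/-- Refutation of a list of ports each of which is to be joined to a leaf. -/
noncomputable def lgo (fuel : Nat) : Nat → List Port → Bool :=
  Nat.rec (fun _ _ => false) (fun _ ih A ts =>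
    cond (allNZ A ts)
      ((fun (ks : Port → List Port → Bool) => selK A (List.rec false (fun t r _ => ks t r) ts) ts ks)
        (fun t r =>
          lall (fun o => cond (nz (Nat.land A o.bit))
            (force (Nat.xor (Nat.land (Nat.land A o.keep) o.ninc) o.tag) fun B => ih B r) true) t.opts))
      true) fuel

/-- Evaluated append. -/
noncomputable def appK {α : Type} (l' : List α) (l : List α) : (List α → Bool) → Bool :=
  List.rec (fun k => k l') (fun h _ ih k => ih fun t => k (h :: t)) l

/-- Ports of the row of `o.q` available for the children. -/
noncomputable def freePorts (T : List (List Port)) (o : Opt) : List Port :=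
  List.eraseIdx (nth [] T o.q) o.e

/-- Refutation of a list of ports `hs` each of which is to be joined to a vertex with the given
number of leaf children. -/
noncomputable def hgo (T : List (List Port)) (fin : Nat → Nat → List Port → Bool)
    (hs : List (Port × Nat)) : Nat → Nat → List Port → Bool :=
  List.rec (fun A NI lf => cond (allNZ A lf) (fin A NI lf) true)
    (fun t ts ih A NI lf =>
      cond (and (nz (Nat.land A t.1.mask)) (and (lall (fun t => nz (Nat.land A t.1.mask)) ts) (allNZ A lf)))
        (lall (fun o => cond (nz (Nat.land A o.bit))
          (force (Nat.xor (Nat.land (Nat.land A o.keep) (Nat.lor o.ninc NI)) o.tag) fun B =>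
            force (Nat.xor (Nat.land NI o.ninc) o.tag) fun NI' =>
            lall (fun al => appK lf al (ih B NI')) (List.sublistsLen t.2 (freePorts T o)))
          true) t.1.opts) true) hs

/-- All ways to pick an element of a list. -/
noncomputable def splits {α : Type} (l : List α) : List (α × List α) :=
  List.rec [] (fun a l ih => (a, l) :: ih.map (fun x => (x.1, a :: x.2))) l

/-- Evaluated conjunction over all ways to pick an element of a list. -/
noncomputable def splitK {α : Type} (l : List α) : (α → List α → Bool) → Bool :=
  List.rec (fun _ => true) (fun a l ih f => and (f a l) (ih fun x r => f x (a :: r))) l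

/-- Final stage without a special vertex. -/
noncomputable def fin0 (A _NI : Nat) (lf : List Port) : Bool := lgo 14 A lf

/-- Final stage with a special vertex with `j` children. -/
noncomputable def fin1 (T : List (List Port)) (j : Nat) (A NI : Nat) (lf : List Port) : Bool :=
  or (lgo 14 A lf)
    (splitK lf fun t r => lall (fun o => cond (nz (Nat.land A o.bit))
      (force (Nat.xor (Nat.land (Nat.land A o.keep) (Nat.lor o.ninc NI)) o.tag) fun B =>
        lall (fun al => appK r al (lgo 15 B)) (List.sublistsLen j (freePorts T o)))
      true) t.opts)

/-- The whole search. -/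
noncomputable def search (n Y : Nat) (fin : List (List Port) → Nat → Nat → List Port → Bool)
    (ra : List Port → List (List (Port × Nat) × List Port)) : Bool :=
  withTab n Y fun T =>
    lall (fun p => force (nincMask n p) fun NI => force (Nat.pred (Nat.pow 2 (Nat.add (Nat.mul n n) 64))) fun A =>
      lall (fun x => hgo T (fin T) x.1 A NI x.2) (ra (nth [] T p))) (List.range n)

def ra13 (row : List Port) : List (List (Port × Nat) × List Port) :=
  (List.sublistsLen 3 row).map fun l => (l.map (fun t => (t, 3)), [])
noncomputable def ra14 (row : List Port) : List (List (Port × Nat) × List Port) :=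
  (splits row).map fun x => (x.2.map (fun t => (t, 3)), [x.1])
noncomputable def ra16 (row : List Port) : List (List (Port × Nat) × List Port) :=
  (splits row).map fun x => (x.2.map (fun t => (t, 3)) ++ [(x.1, 2)], [])
def ra17 (row : List Port) : List (List (Port × Nat) × List Port) :=
  [(row.map (fun t => (t, 3)), [])]


def Y13 : Nat := 1585446429027216618

def Y14 : Nat := 154566922856797875463

def Y16 : Nat := 390853232513089749064872

def Y17 : Nat := 7446065284515869806042411

def Y18 : Nat := 278057738305402030855106856

def Y19 : Nat := 5186405289225067355345240491

def Y20 : Nat := 366632389556550815214925658474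

set_option linter.unusedSimpArgs false
set_option linter.unnecessarySimpa false

/-! ### Evaluation helpers -/

theorem force_eq {β : Type} (x : Nat) (k : Nat → β) : force x k = k x := by
  cases x <;> rfl

theorem lall_cons {α : Type} (p : α → Bool) (a : α) (l : List α) :
    lall p (a :: l) = (p a && lall p l) := rfl

theorem lall_true {α : Type} (p : α → Bool) (l : List α) :
    lall p l = true ↔ ∀ x ∈ l, p x = true := by
  induction l with
  | nil => simp [lall]
  | cons a l ih => simp [lall_cons, ih]

theorem lall_false {α : Type} {p : α → Bool} {l : List α} {x : α} (hx : x ∈ l)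
    (h : p x = false) : lall p l = false := by
  rw [Bool.eq_false_iff, Ne, lall_true]
  intro h'
  rw [h' x hx] at h
  exact absurd h (by simp)

theorem forceList_eq {α : Type} {fo : α → (α → Bool) → Bool} (hfo : ∀ a k, fo a k = k a)
    (l : List α) (k : List α → Bool) : forceList fo l k = k l := by
  induction l generalizing k with
  | nil => rfl
  | cons a l ih =>
    change fo a (fun h' => forceList fo l (fun t => k (h' :: t))) = _
    rw [hfo, ih]

theorem forcePM_eq (o : PM) (k : PM → Bool) : forcePM o k = k o := by
  cases o
  simp [forcePM, force_eq]

theorem forceOpt_eq (o : Opt) (k : Opt → Bool) : forceOpt o k = k o := by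
  cases o
  simp [forceOpt, force_eq]

theorem forcePort_eq (o : Port) (k : Port → Bool) : forcePort o k = k o := by
  cases o
  simp [forcePort, force_eq, forceList_eq forceOpt_eq]

/-- The table. -/
noncomputable def tab (n Y : Nat) : List (List Port) :=
  tabWith n Y (keepList n (pmList n Y)) (nincList n)

theorem withTab_eq (n Y : Nat) (k : List (List Port) → Bool) :
    withTab n Y k = k (tab n Y) := by
  unfold withTab tab
  rw [forceList_eq forcePM_eq, forceList_eq (forceList_eq force_eq), forceList_eq force_eq,
    forceList_eq (forceList_eq forcePort_eq)]

theorem appK_eq {α : Type} (l' l : List α) (k : List α → Bool) : appK l' l k = k (l ++ l') := by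
  induction l generalizing k with
  | nil => rfl
  | cons a l ih =>
    change appK l' l (fun t => k (a :: t)) = _
    rw [ih]; rfl

theorem nth_eq {α : Type} (d : α) (l : List α) (i : Nat) : nth d l i = (l[i]?).getD d := by
  induction l generalizing i with
  | nil => rfl
  | cons a l ih =>
    cases i with
    | zero => rfl
    | succ i =>
      change nth d l i = _
      rw [ih]; simp

theorem nth_map_range {α : Type} (d : α) (f : Nat → α) {n i : Nat} (h : i < n) :
    nth d ((List.range n).map f) i = f i := by
  simp [nth_eq, h]

theorem splitK_false {α : Type} (l₁ : List α) (x : α) (l₂ : List α) (f : α → List α → Bool)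
    (h : f x (l₁ ++ l₂) = false) : splitK (l₁ ++ x :: l₂) f = false := by
  induction l₁ generalizing f with
  | nil =>
    change (f x l₂ && _) = false
    simp only [List.nil_append] at h
    rw [h]; rfl
  | cons a l ih =>
    change (f a (l ++ x :: l₂) && splitK (l ++ x :: l₂) (fun x r => f x (a :: r))) = false
    rw [ih _ h]; simp

theorem mem_splits {α : Type} (l₁ : List α) (x : α) (l₂ : List α) :
    (x, l₁ ++ l₂) ∈ splits (l₁ ++ x :: l₂) := by
  induction l₁ with
  | nil => exact List.mem_cons_self
  | cons a l ih =>
    change _ ∈ (a, l ++ x :: l₂) :: (splits (l ++ x :: l₂)).map (fun x => (x.1, a :: x.2))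
    exact List.mem_cons_of_mem _ (List.mem_map.2 ⟨_, ih, rfl⟩)

theorem beq_false {a b : Nat} (h : a ≠ b) : Nat.beq a b = false := by
  rw [Bool.eq_false_iff, Ne, Nat.beq_eq]; exact h

theorem nz_of_bit {A B i : Nat} (hA : A.testBit i = true) (hB : B.testBit i = true) :
    nz (Nat.land A B) = true := by
  have : Nat.land A B ≠ 0 := by
    intro h
    have h2 : (A &&& B).testBit i = true := by rw [Nat.testBit_and, hA, hB]; rfl
    change Nat.land A B = 0 at h
    have h3 : (A &&& B) = 0 := h
    rw [h3] at h2
    simp at h2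
  unfold nz
  rw [beq_false this]; rfl

/-! ### Masks -/

theorem mk_bit (f : Nat → Bool) (m b : Nat) :
    (mk f m).testBit b = (decide (b < m) && f b) := by
  induction m with
  | zero => simp [mk]
  | succ m ih =>
    change (cond (f m) (2 ^ m) 0 ||| mk f m).testBit b = _
    rw [Nat.testBit_or, ih]
    rcases lt_trichotomy b m with h | h | h
    · have : ¬ m = b := by omega
      have h2 : b < m + 1 := by omega
      cases f m <;> simp [Nat.testBit_two_pow, this, h, h2]
    · subst h
      cases hf : f b <;> simp [hf]
    · have : ¬ m = b := by omega
      have h2 : ¬ b < m + 1 := by omega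
      have h3 : ¬ b < m := by omega
      cases f m <;> simp [Nat.testBit_two_pow, this, h2, h3]

theorem mk_lt (f : Nat → Bool) (m : Nat) : mk f m < 2 ^ m := by
  apply Nat.lt_pow_two_of_testBit
  intro i hi
  rw [mk_bit]
  simp; omega

theorem grid_bit (n : Nat) (hn : 0 < n) (g : Nat → Nat) (hg : ∀ k, g k < 2 ^ n) (m b : Nat) :
    (grid n g m).testBit b = (decide (b < n * m) && (g (b / n)).testBit (b % n)) := by
  induction m with
  | zero => simp [grid]
  | succ m ih =>
    change ((g m <<< (n * m)) ||| grid n g m).testBit b = _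
    rw [Nat.testBit_or, ih, Nat.testBit_shiftLeft]
    have e : n * (m + 1) = n * m + n := by ring
    by_cases h : b < n * m
    · have h1 : ¬ n * m ≤ b := by omega
      have h2 : b < n * (m + 1) := by omega
      simp [h, h2]
    · by_cases h2 : b < n * (m + 1)
      · have hd : b / n = m := by
          apply Nat.div_eq_of_lt_le
          · rw [mul_comm]; omega
          · rw [mul_comm]; omega
        have hm : b % n = b - n * m := by
          have := Nat.div_add_mod b n
          rw [hd] at this; omega
        have h1 : n * m ≤ b := by omega
        simp [h, h2, hd, hm, h1]
      · have h1 : (g m).testBit (b - n * m) = false :=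
          Nat.testBit_lt_two_pow (lt_of_lt_of_le (hg m) (Nat.pow_le_pow_right (by norm_num) (by omega)))
        simp [h, h2, h1]

theorem rows_bit (n : Nat) (hn : 0 < n) (f : Nat → Bool) (b : Nat) :
    (rows n f).testBit b = (decide (b < n * n) && f (b / n)) := by
  unfold rows
  rw [force_eq, grid_bit n hn]
  · have h : b % n < n := Nat.mod_lt _ hn
    have : (Nat.pred (Nat.pow 2 n)).testBit (b % n) = true := by
      change (2 ^ n - 1).testBit (b % n) = true
      rw [Nat.testBit_two_pow_sub_one]; simpa using h
    cases f (b / n)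
    · simp
    · simp only [cond_true, this]
  · intro k
    have : 0 < 2 ^ n := by positivity
    cases f k
    · simpa using this
    · change 2 ^ n - 1 < 2 ^ n
      omega

theorem cols_bit (n : Nat) (hn : 0 < n) (f : Nat → Bool) (b : Nat) :
    (cols n f).testBit b = (decide (b < n * n) && f (b % n)) := by
  unfold cols
  rw [force_eq, grid_bit n hn]
  · rw [mk_bit]
    have h : b % n < n := Nat.mod_lt _ hn
    simp [h]
  · intro k; exact mk_lt _ _

theorem sh_bit (x b : Nat) : (sh x).testBit (b + 64) = x.testBit b := by
  change (x <<< 64 ||| 18446744073709551615).testBit (b + 64) = _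
  rw [Nat.testBit_or, Nat.testBit_shiftLeft]
  have : Nat.testBit 18446744073709551615 (b + 64) = false :=
    Nat.testBit_lt_two_pow (lt_of_lt_of_le (by norm_num : _ < 2 ^ 64)
      (Nat.pow_le_pow_right (by norm_num) (by omega)))
  simp [this]

theorem tag_bit (c b : Nat) : (tagOf c).testBit (b + 64) = false := by
  apply Nat.testBit_lt_two_pow
  apply lt_of_lt_of_le (b := 2 ^ 64)
  · exact Nat.mod_lt _ (by norm_num)
  · exact Nat.pow_le_pow_right (by norm_num) (by omega)

theorem land_bit (a b i : Nat) : (Nat.land a b).testBit i = (a.testBit i && b.testBit i) :=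
  Nat.testBit_and a b i
theorem lor_bit (a b i : Nat) : (Nat.lor a b).testBit i = (a.testBit i || b.testBit i) :=
  Nat.testBit_or a b i
theorem xor_bit (a b i : Nat) : (Nat.xor a b).testBit i = (a.testBit i ^^ b.testBit i) :=
  Nat.testBit_xor a b i

theorem ninc_bit {n p r s : Nat} (hr : r < n) (hs : s < n) (h1 : r ≠ p) (h2 : s ≠ p) :
    (nincMask n p).testBit (r * n + s + 64) = true := by
  have hn : 0 < n := by omega
  have hd : (r * n + s) / n = r := by
    rw [mul_comm, Nat.mul_add_div hn, Nat.div_eq_of_lt hs]; rfl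
  have hm : (r * n + s) % n = s := by
    rw [mul_comm, Nat.mul_add_mod, Nat.mod_eq_of_lt hs]
  have hl : r * n + s < n * n := by nlinarith
  unfold nincMask
  rw [sh_bit, land_bit, rows_bit n hn, cols_bit n hn, hd, hm]
  simp [hl, beq_false h1, beq_false h2]

theorem keep_bit {n Y p q r s : Nat} (hr : r < n) (hs : s < n) (h : okc Y p q r s = true) :
    (keepOf n (pmOf n Y p) (pmOf n Y q)).testBit (r * n + s + 64) = true := by
  have hn : 0 < n := by omega
  have hd : (r * n + s) / n = r := by
    rw [mul_comm, Nat.mul_add_div hn, Nat.div_eq_of_lt hs]; rfl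
  have hm : (r * n + s) % n = s := by
    rw [mul_comm, Nat.mul_add_mod, Nat.mod_eq_of_lt hs]
  have hl : r * n + s < n * n := by nlinarith
  unfold keepOf
  rw [sh_bit, xor_bit]
  have h1 : (Nat.pred (Nat.pow 2 (Nat.mul n n))).testBit (r * n + s) = true := by
    change (2 ^ (n * n) - 1).testBit _ = true
    rw [Nat.testBit_two_pow_sub_one]; simpa using hl
  rw [h1]
  simp only [pmOf, land_bit, lor_bit, rows_bit n hn, cols_bit n hn, hd, hm, hl, decide_true,
    Bool.true_and]
  simp only [okc, hit, btw] at h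
  generalize yc Y p = yp at *
  generalize yc Y q = yq at *
  generalize yc Y r = yr at *
  generalize yc Y s = ys at *
  simp only [Bool.and_eq_true, Bool.or_eq_true, Bool.not_eq_true', Bool.and_eq_false_iff,
    Bool.or_eq_false_iff, Bool.not_eq_false', Bool.true_xor, Bool.not_eq_true', Nat.blt, Nat.ble_eq, Nat.beq_eq,
    ← Bool.not_eq_true] at h ⊢
  omega


/-! ### Abstract embeddings and soundness of the search -/

/-- A drawing of a rooted tree, in terms of ports. -/
structure Emb (V : Type) (n Y : Nat) (par : V → V) (root : V) where
  pos : V → Nat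
  pp : V → Nat
  pos_lt : ∀ v, pos v < n
  pos_inj : Function.Injective pos
  pp_lt : ∀ v, pp v < 4
  side_ok : ∀ v, v ≠ root → side Y (pp v) (pos (par v)) (pos v) = true
  ok : ∀ v w, v ≠ root → w ≠ root → v ≠ w →
    okc Y (fstE (pp v) (pos (par v)) (pos v)) (sndE (pp v) (pos (par v)) (pos v))
      (fstE (pp w) (pos (par w)) (pos w)) (sndE (pp w) (pos (par w)) (pos w)) = true

/-- The port `d` of `p`. -/
noncomputable def thePort (n Y p d : Nat) : Port :=
  portWith n Y (keepList n (pmList n Y)) (nincList n) p d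

theorem tab_row {n Y p : Nat} (hp : p < n) :
    nth [] (tab n Y) p = [0, 1, 2, 3].map (thePort n Y p) :=
  nth_map_range _ _ hp

namespace Emb

variable {V : Type} {n Y : Nat} {par : V → V} {root : V}

def cd (E : Emb V n Y par root) (v : V) : Nat :=
  codeE n (E.pp v) (E.pos (par v)) (E.pos v) + 64

noncomputable def prt (E : Emb V n Y par root) (v : V) : Port :=
  thePort n Y (E.pos (par v)) (E.pp v)

noncomputable def opt (E : Emb V n Y par root) (v : V) : Opt :=
  optOf n Y (keepList n (pmList n Y)) (nincList n) (E.pp v) (E.pos (par v)) (E.pos v)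

def ent (E : Emb V n Y par root) (v : V) : Nat :=
  entry Y (E.pp v) (E.pos (par v)) (E.pos v)

theorem opt_mem (E : Emb V n Y par root) {v : V} (hv : v ≠ root) : E.opt v ∈ (E.prt v).opts :=
  List.mem_map.2 ⟨E.pos v, List.mem_filter.2 ⟨List.mem_range.2 (E.pos_lt v), E.side_ok v hv⟩, rfl⟩

theorem opt_bit (E : Emb V n Y par root) (v : V) : (E.opt v).bit.testBit (E.cd v) = true := by
  change (2 ^ (E.cd v)).testBit (E.cd v) = true
  simp

theorem orBits_bit {l : List Opt} {o : Opt} (ho : o ∈ l) {b : Nat} (hb : o.bit.testBit b = true) :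
    (orBits l).testBit b = true := by
  induction l with
  | nil => simp at ho
  | cons a l ih =>
    change (Nat.lor a.bit (orBits l)).testBit b = true
    rw [lor_bit]
    rcases List.mem_cons.1 ho with rfl | h
    · simp [hb]
    · simp [ih h]

theorem mask_bit (E : Emb V n Y par root) {v : V} (hv : v ≠ root) :
    (E.prt v).mask.testBit (E.cd v) = true :=
  orBits_bit (E.opt_mem hv) (E.opt_bit v)

theorem fst_lt (E : Emb V n Y par root) (v : V) :
    fstE (E.pp v) (E.pos (par v)) (E.pos v) < n := by
  unfold fstE
  cases Nat.blt (E.pp v) 2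
  · exact E.pos_lt _
  · exact E.pos_lt _

theorem snd_lt (E : Emb V n Y par root) (v : V) :
    sndE (E.pp v) (E.pos (par v)) (E.pos v) < n := by
  unfold sndE
  cases Nat.blt (E.pp v) 2
  · exact E.pos_lt _
  · exact E.pos_lt _

theorem opt_keep (E : Emb V n Y par root) {v w : V} (hv : v ≠ root) (hw : w ≠ root) (h : v ≠ w) :
    (E.opt v).keep.testBit (E.cd w) = true := by
  have := keep_bit (E.fst_lt w) (E.snd_lt w) (E.ok v w hv hw h)
  unfold opt optOf
  simp only [keepList, pmList, List.map_map]
  rw [nth_map_range _ _ (E.fst_lt v)]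
  simp only [Function.comp]
  rw [nth_map_range _ _ (E.snd_lt v)]
  exact this

theorem ninc_cd (E : Emb V n Y par root) {u w : V} (h1 : u ≠ w) (h2 : u ≠ par w) :
    (nincMask n (E.pos u)).testBit (E.cd w) = true := by
  have h3 : E.pos w ≠ E.pos u := fun h => h1 (E.pos_inj h.symm)
  have h4 : E.pos (par w) ≠ E.pos u := fun h => h2 (E.pos_inj h.symm)
  apply ninc_bit (E.fst_lt w) (E.snd_lt w)
  · unfold fstE
    cases Nat.blt (E.pp w) 2
    · exact h3
    · exact h4
  · unfold sndE
    cases Nat.blt (E.pp w) 2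
    · exact h4
    · exact h3

theorem opt_ninc (E : Emb V n Y par root) (v : V) : (E.opt v).ninc = nincMask n (E.pos v) := by
  unfold opt optOf nincList
  exact nth_map_range _ _ (E.pos_lt v)

theorem opt_tag (E : Emb V n Y par root) (v w : V) : (E.opt v).tag.testBit (E.cd w) = false :=
  tag_bit _ _

/-- The state of the search is compatible with the drawing. -/
def Inv (E : Emb V n Y par root) (A NI : Nat) (W : V → Prop) : Prop :=
  ∀ w, W w → w ≠ root ∧ A.testBit (E.cd w) = true ∧ (W (par w) → NI.testBit (E.cd w) = true)

theorem Inv.step {E : Emb V n Y par root} {A NI : Nat} {W : V → Prop} (hI : E.Inv A NI W)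
    {v : V} (hv : W v) :
    E.Inv (Nat.xor (Nat.land (Nat.land A (E.opt v).keep) (Nat.lor (E.opt v).ninc NI)) (E.opt v).tag)
      (Nat.xor (Nat.land NI (E.opt v).ninc) (E.opt v).tag) (fun w => W w ∧ w ≠ v) := by
  rintro w ⟨hw, hwv⟩
  obtain ⟨hr, hA, hN⟩ := hI w hw
  have hvr := (hI v hv).1
  refine ⟨hr, ?_, ?_⟩
  · rw [xor_bit, land_bit, land_bit, lor_bit, E.opt_tag, hA, E.opt_keep hvr hr (Ne.symm hwv)]
    by_cases hp : v = par w
    · rw [hN (hp ▸ hv)]; simp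
    · rw [E.opt_ninc, E.ninc_cd (Ne.symm hwv) hp]; simp
  · rintro ⟨hp, hpv⟩
    rw [xor_bit, land_bit, E.opt_tag, hN hp, E.opt_ninc, E.ninc_cd (Ne.symm hwv) (Ne.symm hpv)]
    rfl

theorem allNZ_true (E : Emb V n Y par root) {A : Nat} {vs : List V}
    (h : ∀ v ∈ vs, v ≠ root ∧ A.testBit (E.cd v) = true) : allNZ A (vs.map E.prt) = true := by
  unfold allNZ
  rw [lall_true]
  intro t ht
  obtain ⟨v, hv, rfl⟩ := List.mem_map.1 ht
  exact nz_of_bit (h v hv).2 (E.mask_bit (h v hv).1)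

theorem selK_false (E : Emb V n Y par root) (A : Nat) (kn : Bool) (hkn : kn = false) (vs : List V)
    (ks : Port → List Port → Bool)
    (h : ∀ v rest, List.Perm vs (v :: rest) → ks (E.prt v) (rest.map E.prt) = false) :
    selK A kn (vs.map E.prt) ks = false := by
  induction vs generalizing ks with
  | nil => exact hkn
  | cons a l ih =>
    change cond _ (ks (E.prt a) (l.map E.prt))
      (selK A kn (l.map E.prt) (fun u r => ks u (E.prt a :: r))) = false
    rw [h a l (List.Perm.refl _), ih]
    · simp
    · intro v rest hp
      exact h v (a :: rest) ((List.Perm.cons a hp).trans (List.Perm.swap _ _ _))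

theorem lgo_false (E : Emb V n Y par root) (fuel : Nat) (A : Nat) (vs : List V)
    (hnd : vs.Nodup) (h : ∀ v ∈ vs, v ≠ root ∧ A.testBit (E.cd v) = true)
    (hp : ∀ v ∈ vs, ∀ w ∈ vs, par w ≠ v) : lgo fuel A (vs.map E.prt) = false := by
  induction fuel generalizing A vs with
  | zero => rfl
  | succ f ih =>
    change cond (allNZ A (vs.map E.prt)) _ true = false
    rw [E.allNZ_true h, cond_true]
    have key : ∀ v rest, List.Perm vs (v :: rest) →
        lall (fun o => cond (nz (Nat.land A o.bit))
            (force (Nat.xor (Nat.land (Nat.land A o.keep) o.ninc) o.tag)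
              fun B => lgo f B (rest.map E.prt)) true) (E.prt v).opts = false := by
      intro v rest hperm
      have hv : v ∈ vs := hperm.mem_iff.2 List.mem_cons_self
      have hr : ∀ w ∈ rest, w ∈ vs := fun w hw => hperm.mem_iff.2 (List.mem_cons_of_mem _ hw)
      have hnd2 := hperm.nodup_iff.1 hnd
      rw [List.nodup_cons] at hnd2
      apply lall_false (E.opt_mem (h v hv).1)
      rw [nz_of_bit (h v hv).2 (E.opt_bit v), cond_true, force_eq]
      apply ih _ _ hnd2.2
      · intro w hw
        have hvw : v ≠ w := fun e => hnd2.1 (e ▸ hw)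
        refine ⟨(h w (hr w hw)).1, ?_⟩
        rw [xor_bit, land_bit, land_bit, E.opt_tag, (h w (hr w hw)).2,
          E.opt_keep (h v hv).1 (h w (hr w hw)).1 hvw, E.opt_ninc,
          E.ninc_cd hvw (Ne.symm (hp v hv w (hr w hw)))]
        rfl
      · intro a ha b hb
        exact hp a (hr a ha) b (hr b hb)
    apply E.selK_false
    · cases vs with
      | nil => rfl
      | cons a l => exact key a l (List.Perm.refl _)
    · exact key

/-- All children of `hs`, followed by `vs`. -/
def collect (cs : V → List V) (hs vs : List V) : List V :=
  hs.foldl (fun l h => cs h ++ l) vs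

theorem mem_collect {cs : V → List V} {hs vs : List V} {x : V} :
    x ∈ collect cs hs vs ↔ x ∈ vs ∨ ∃ h ∈ hs, x ∈ cs h := by
  induction hs generalizing vs with
  | nil => simp [collect]
  | cons h hs ih =>
    change x ∈ collect cs hs (cs h ++ vs) ↔ _
    rw [ih]
    simp only [List.mem_append, List.mem_cons, exists_eq_or_imp]
    tauto

theorem nodup_collect {cs : V → List V} {hs vs : List V} (hvs : vs.Nodup) (hhs : hs.Nodup)
    (hcs : ∀ h ∈ hs, (cs h).Nodup) (hpar : ∀ h ∈ hs, ∀ x ∈ cs h, par x = h)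
    (hv : ∀ x ∈ vs, par x ∉ hs) : (collect cs hs vs).Nodup := by
  induction hs generalizing vs with
  | nil => exact hvs
  | cons h hs ih =>
    change (collect cs hs (cs h ++ vs)).Nodup
    rw [List.nodup_cons] at hhs
    apply ih
    · rw [List.nodup_append]
      refine ⟨hcs h List.mem_cons_self, hvs, ?_⟩
      rintro a ha b hb rfl
      apply hv a hb
      rw [hpar h List.mem_cons_self a ha]
      exact List.mem_cons_self
    · exact hhs.2
    · exact fun k hk => hcs k (List.mem_cons_of_mem _ hk)
    · exact fun k hk => hpar k (List.mem_cons_of_mem _ hk)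
    · intro x hx
      rcases List.mem_append.1 hx with hx | hx
      · rw [hpar h List.mem_cons_self x hx]; exact hhs.1
      · exact fun h' => hv x hx (List.mem_cons_of_mem _ h')

theorem hgo_false (E : Emb V n Y par root) (_hpar : ∀ v, v ≠ root → par v ≠ v)
    (T : List (List Port)) (fin : Nat → Nat → List Port → Bool)
    (cs : V → List V) (kc : V → Nat) (hs vs : List V) (A NI : Nat) (W : V → Prop)
    (hI : E.Inv A NI W) (hhs : hs.Nodup) (hW : ∀ h ∈ hs, W h)
    (hcs : ∀ h ∈ hs, (cs h).map E.prt ∈ List.sublistsLen (kc h) (freePorts T (E.opt h)))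
    (hres : ∀ x ∈ collect cs hs vs, W x ∧ x ∉ hs)
    (hfin : ∀ A' NI', E.Inv A' NI' (fun x => W x ∧ x ∉ hs) →
      fin A' NI' ((collect cs hs vs).map E.prt) = false) :
    hgo T fin (hs.map fun v => (E.prt v, kc v)) A NI (vs.map E.prt) = false := by
  induction hs generalizing vs A NI W with
  | nil =>
    change cond (allNZ A (vs.map E.prt)) (fin A NI (vs.map E.prt)) true = false
    rw [E.allNZ_true, cond_true]
    · apply hfin
      simpa using hI
    · intro v hv
      have := hI v (hres v hv).1
      exact ⟨this.1, this.2.1⟩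
  | cons h hs ih =>
    have hvs : ∀ v ∈ vs, W v := fun v hv => (hres v (mem_collect.2 (Or.inl hv))).1
    have hnz : ∀ v, W v → nz (Nat.land A (E.prt v).mask) = true := fun v hv =>
      nz_of_bit (hI v hv).2.1 (E.mask_bit (hI v hv).1)
    have hWh := hW h List.mem_cons_self
    change cond (and (nz (Nat.land A (E.prt h).mask)) (and (lall (fun t => nz (Nat.land A t.1.mask))
      (hs.map fun v => (E.prt v, kc v))) (allNZ A (vs.map E.prt)))) _ true = false
    rw [hnz h hWh, E.allNZ_true (fun v hv => ⟨(hI v (hvs v hv)).1, (hI v (hvs v hv)).2.1⟩),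
      (lall_true _ _).2]
    · change lall _ (E.prt h).opts = false
      apply lall_false (E.opt_mem (hI h hWh).1)
      rw [nz_of_bit (hI h hWh).2.1 (E.opt_bit h), cond_true, force_eq, force_eq]
      apply lall_false (hcs h List.mem_cons_self)
      rw [appK_eq, ← List.map_append]
      rw [List.nodup_cons] at hhs
      apply ih (cs h ++ vs) _ _ _ (hI.step hWh) hhs.2
      · intro k hk
        exact ⟨hW k (List.mem_cons_of_mem _ hk), fun e => hhs.1 (e ▸ hk)⟩
      · exact fun k hk => hcs k (List.mem_cons_of_mem _ hk)
      · intro x hx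
        have := hres x hx
        rw [List.mem_cons, not_or] at this
        exact ⟨⟨this.1, this.2.1⟩, this.2.2⟩
      · intro A' NI' h'
        apply hfin
        intro x hx
        simp only [List.mem_cons, not_or] at hx
        obtain ⟨a, b, c⟩ := h' x ⟨⟨hx.1, hx.2.1⟩, hx.2.2⟩
        refine ⟨a, b, fun d => c ?_⟩
        simp only [List.mem_cons, not_or] at d
        exact ⟨⟨d.1, d.2.1⟩, d.2.2⟩
    · intro t ht
      obtain ⟨v, hv, rfl⟩ := List.mem_map.1 ht
      exact hnz v (hW v (List.mem_cons_of_mem _ hv))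

theorem fin1_false (E : Emb V n Y par root) (hpar : ∀ v, v ≠ root → par v ≠ v)
    (T : List (List Port)) (j : Nat) (A NI : Nat) (W : V → Prop) (hI : E.Inv A NI W)
    (cs : V → List V) (sp : V) (vs : List V) (hsp : sp ∈ vs) (hnd : vs.Nodup)
    (hvs : ∀ v ∈ vs, W v) (hp : ∀ v ∈ vs, ∀ w ∈ vs, par w ≠ v)
    (hcs : (cs sp).map E.prt ∈ List.sublistsLen j (freePorts T (E.opt sp)))
    (hcn : (cs sp).Nodup) (hcW : ∀ x ∈ cs sp, W x) (hcp : ∀ x ∈ cs sp, par x = sp)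
    (hcc : ∀ x ∈ cs sp, ∀ v ∈ vs, par v ≠ x) :
    fin1 T j A NI (vs.map E.prt) = false := by
  unfold fin1
  rw [E.lgo_false 14 A vs hnd (fun v hv => ⟨(hI v (hvs v hv)).1, (hI v (hvs v hv)).2.1⟩) hp]
  obtain ⟨l₁, l₂, rfl⟩ := List.append_of_mem hsp
  rw [List.map_append, List.map_cons, splitK_false]
  · rfl
  have hsr := (hI sp (hvs sp hsp)).1
  apply lall_false (E.opt_mem hsr)
  rw [nz_of_bit (hI sp (hvs sp hsp)).2.1 (E.opt_bit sp), cond_true, force_eq]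
  apply lall_false hcs
  rw [appK_eq, ← List.map_append, ← List.map_append]
  have hsub : ∀ x ∈ l₁ ++ l₂, x ∈ l₁ ++ sp :: l₂ := by
    intro x hx
    simp only [List.mem_append, List.mem_cons] at hx ⊢
    tauto
  have hnd' : (sp :: (l₁ ++ l₂)).Nodup := (List.perm_middle.nodup_iff).1 hnd
  rw [List.nodup_cons] at hnd'
  have hI' := hI.step (hvs sp hsp)
  apply E.lgo_false
  · rw [List.nodup_append]
    refine ⟨hcn, hnd'.2, ?_⟩
    rintro a ha b hb rfl
    exact hp sp hsp a (hsub a hb) (hcp a ha)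
  · intro v hv
    have : W v ∧ v ≠ sp := by
      rcases List.mem_append.1 hv with hv | hv
      · refine ⟨hcW v hv, ?_⟩
        rintro rfl
        exact hpar v hsr (hcp v hv)
      · exact ⟨hvs v (hsub v hv), fun e => hnd'.1 (e ▸ hv)⟩
    exact ⟨(hI' v this).1, (hI' v this).2.1⟩
  · intro v hv w hw
    rcases List.mem_append.1 hw with hw | hw
    · rw [hcp w hw]
      rintro rfl
      rcases List.mem_append.1 hv with hv | hv
      · exact hpar sp hsr (hcp sp hv)
      · exact hnd'.1 hv
    · rcases List.mem_append.1 hv with hv | hv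
      · exact hcc v hv w (hsub w hw)
      · exact hp v (hsub v hv) w (hsub w hw)

end Emb


/-! ### Children lists -/

theorem exists_list {V : Type} [DecidableEq V] (f : V → Nat) (ds : List Nat) (s : Finset V)
    (hf : ∀ x ∈ s, ∀ y ∈ s, f x = f y → x = y) (hd : ∀ x ∈ s, f x ∈ ds) :
    ∃ cs : List V, cs.Nodup ∧ (∀ x, x ∈ cs ↔ x ∈ s) ∧ (cs.map f).Sublist ds := by
  induction ds generalizing s with
  | nil =>
    refine ⟨[], List.nodup_nil, fun x => ?_, List.Sublist.refl _⟩
    constructor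
    · intro h; simp at h
    · intro h; have := hd x h; simp at this
  | cons d ds ih =>
    by_cases hx : ∃ x ∈ s, f x = d
    · obtain ⟨x, hxs, hxd⟩ := hx
      obtain ⟨cs, h1, h2, h3⟩ := ih (s.erase x)
        (fun a ha b hb => hf a (Finset.mem_of_mem_erase ha) b (Finset.mem_of_mem_erase hb))
        (fun a ha => by
          have h4 := Finset.mem_erase.1 ha
          rcases List.mem_cons.1 (hd a h4.2) with h5 | h5
          · exact absurd (hf a h4.2 x hxs (h5.trans hxd.symm)) h4.1
          · exact h5)
      refine ⟨x :: cs, ?_, ?_, ?_⟩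
      · rw [List.nodup_cons, h2]
        exact ⟨Finset.notMem_erase _ _, h1⟩
      · intro y
        rw [List.mem_cons, h2, Finset.mem_erase]
        constructor
        · rintro (rfl | h)
          · exact hxs
          · exact h.2
        · intro h
          by_cases e : y = x
          · exact Or.inl e
          · exact Or.inr ⟨e, h⟩
      · rw [List.map_cons, hxd]
        exact h3.cons_cons d
    · obtain ⟨cs, h1, h2, h3⟩ := ih s hf (fun a ha => by
        rcases List.mem_cons.1 (hd a ha) with h5 | h5
        · exact absurd ⟨a, ha, h5⟩ hx
        · exact h5)
      exact ⟨cs, h1, h2, h3.cons d⟩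

/-- Set of children. -/
def kids {V : Type} [Fintype V] [DecidableEq V] (par : V → V) (root h : V) : Finset V :=
  Finset.univ.filter fun x => x ≠ root ∧ par x = h

theorem mem_kids {V : Type} [Fintype V] [DecidableEq V] {par : V → V} {root h x : V} :
    x ∈ kids par root h ↔ x ≠ root ∧ par x = h := by
  simp [kids]

theorem hit_iff {Y p q r s : Nat} : hit Y p q r s = true ↔
    s ≠ p ∧ ((p ≤ s ∧ s ≤ q) ∨ (q ≤ s ∧ s ≤ p)) ∧
      ((yc Y r ≤ yc Y p ∧ yc Y p ≤ yc Y s) ∨ (yc Y s ≤ yc Y p ∧ yc Y p ≤ yc Y r)) := by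
  simp only [hit, btw, Bool.and_eq_true, Bool.or_eq_true, Bool.not_eq_true', Nat.ble_eq,
    ← Bool.not_eq_true, Nat.beq_eq, ne_eq]

theorem okc_false {Y p q r s : Nat} (h : hit Y p q r s = true ∨ hit Y r s p q = true) :
    okc Y p q r s = false := by
  unfold okc
  rcases h with h | h <;> simp [h]

theorem vert_conf {Y h x y : Nat} (hx : x ≠ h) (hy : y ≠ h)
    (hh : (yc Y h ≤ yc Y x ∧ yc Y h ≤ yc Y y) ∨ (yc Y x ≤ yc Y h ∧ yc Y y ≤ yc Y h)) :
    okc Y x h y h = false := by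
  apply okc_false
  rw [hit_iff, hit_iff]
  omega

theorem horiz_conf {Y h x y : Nat} (hh : (h < x ∧ h < y) ∨ (x < h ∧ y < h)) :
    okc Y h x h y = false := by
  apply okc_false
  rw [hit_iff, hit_iff]
  omega

theorem side_iff {Y d p w : Nat} (hd : d < 4) : side Y d p w = true ↔
    (d = 0 ∧ p < w) ∨ (d = 1 ∧ w < p) ∨ (d = 2 ∧ yc Y p < yc Y w) ∨ (d = 3 ∧ yc Y w < yc Y p) := by
  have : d = 0 ∨ d = 1 ∨ d = 2 ∨ d = 3 := by omega
  rcases this with rfl | rfl | rfl | rfl <;> simp [side, Nat.blt, Nat.succ_le_iff]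

theorem same_port {Y d h x y : Nat} (hd : d < 4) (hx : side Y d h x = true)
    (hy : side Y d h y = true) :
    okc Y (fstE d h x) (sndE d h x) (fstE d h y) (sndE d h y) = false := by
  rw [side_iff hd] at hx hy
  rcases hx with hx | hx | hx | hx
  · obtain ⟨rfl, hx⟩ := hx; exact horiz_conf (Y := Y) (h := h) (x := x) (y := y) (by omega)
  · obtain ⟨rfl, hx⟩ := hx; exact horiz_conf (Y := Y) (h := h) (x := x) (y := y) (by omega)
  · obtain ⟨rfl, hx⟩ := hx; exact vert_conf (Y := Y) (h := h) (x := x) (y := y) (by rintro rfl; omega) (by rintro rfl; omega) (by omega)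
  · obtain ⟨rfl, hx⟩ := hx; exact vert_conf (Y := Y) (h := h) (x := x) (y := y) (by rintro rfl; omega) (by rintro rfl; omega) (by omega)

theorem entry_port {Y d d' w h x : Nat} (hd : d < 4) (hd' : d' < 4) (hw : side Y d w h = true)
    (hx : side Y d' h x = true) (e : d' = entry Y d w h) (hwh : w ≠ h) (hxh : x ≠ h) :
    okc Y (fstE d w h) (sndE d w h) (fstE d' h x) (sndE d' h x) = false := by
  have hlt : ∀ a b : Nat, Nat.blt a b = true ↔ a < b := by
    intro a b; simp [Nat.blt, Nat.succ_le_iff]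
  rw [side_iff hd] at hw
  rw [side_iff hd'] at hx
  unfold entry at e
  by_cases h2 : d < 2
  · rw [(hlt _ _).2 h2, cond_true] at e
    have hf : fstE d w h = w ∧ sndE d w h = h := by
      unfold fstE sndE; rw [(hlt _ _).2 h2]; exact ⟨rfl, rfl⟩
    rw [hf.1, hf.2]
    by_cases h3 : yc Y h < yc Y w
    · rw [(hlt _ _).2 h3, cond_true] at e
      subst e
      exact vert_conf (Y := Y) (h := h) (x := w) (y := x) hwh hxh (by omega)
    · rw [Bool.eq_false_iff.2 (fun h => h3 ((hlt _ _).1 h)), cond_false] at e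
      subst e
      exact vert_conf (Y := Y) (h := h) (x := w) (y := x) hwh hxh (by omega)
  · have hb : Nat.blt d 2 = false := Bool.eq_false_iff.2 (fun h => h2 ((hlt _ _).1 h))
    rw [hb, cond_false] at e
    have hf : fstE d w h = h ∧ sndE d w h = w := by
      unfold fstE sndE; rw [hb]; exact ⟨rfl, rfl⟩
    rw [hf.1, hf.2]
    by_cases h3 : h < w
    · rw [(hlt _ _).2 h3, cond_true] at e
      subst e
      exact horiz_conf (Y := Y) (h := h) (x := w) (y := x) (by omega)
    · rw [Bool.eq_false_iff.2 (fun h => h3 ((hlt _ _).1 h)), cond_false] at e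
      subst e
      exact horiz_conf (Y := Y) (h := h) (x := w) (y := x) (by omega)

namespace Emb

variable {V : Type} [Fintype V] [DecidableEq V] {n Y : Nat} {par : V → V} {root : V}

theorem pp_inj (E : Emb V n Y par root) (h : V) :
    ∀ x ∈ kids par root h, ∀ y ∈ kids par root h, E.pp x = E.pp y → x = y := by
  intro x hx y hy e
  rw [mem_kids] at hx hy
  by_contra hne
  have h1 := E.ok x y hx.1 hy.1 hne
  have h2 := E.side_ok x hx.1
  have h3 := E.side_ok y hy.1
  rw [hx.2] at h1 h2
  rw [hy.2] at h1 h3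
  rw [← e] at h1 h3
  rw [same_port (E.pp_lt x) h2 h3] at h1
  exact absurd h1 (by simp)

theorem mem_ports {d : Nat} (hd : d < 4) : d ∈ [0, 1, 2, 3] := by
  have : d = 0 ∨ d = 1 ∨ d = 2 ∨ d = 3 := by omega
  simpa using this

theorem exists_root (E : Emb V n Y par root) (h : V) :
    ∃ cs : List V, cs.Nodup ∧ (∀ x, x ∈ cs ↔ x ∈ kids par root h) ∧
      (cs.map E.pp).Sublist [0, 1, 2, 3] :=
  exists_list E.pp _ _ (E.pp_inj h) (fun x _ => mem_ports (E.pp_lt x))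

theorem map_prt (E : Emb V n Y par root) {h : V} {cs : List V}
    (hcs : ∀ x, x ∈ cs ↔ x ∈ kids par root h) :
    cs.map E.prt = (cs.map E.pp).map (thePort n Y (E.pos h)) := by
  rw [List.map_map]
  apply List.map_congr_left
  intro x hx
  have := (mem_kids.1 ((hcs x).1 hx)).2
  simp only [prt, Function.comp, this]

theorem exists_kids (E : Emb V n Y par root) (hpar : ∀ v, v ≠ root → par v ≠ v) (h : V)
    (hh : h ≠ root) :
    ∃ cs : List V, cs.Nodup ∧ (∀ x, x ∈ cs ↔ x ∈ kids par root h) ∧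
      cs.map E.prt ∈ List.sublistsLen (kids par root h).card (freePorts (tab n Y) (E.opt h)) := by
  have hent : E.ent h < 4 := by
    unfold ent entry
    cases Nat.blt (E.pp h) 2
    · cases Nat.blt (E.pos h) (E.pos (par h)) <;> simp
    · cases Nat.blt (yc Y (E.pos h)) (yc Y (E.pos (par h))) <;> simp
  obtain ⟨cs, h1, h2, h3⟩ := exists_list E.pp ([0, 1, 2, 3].eraseIdx (E.ent h)) _ (E.pp_inj h)
    (by
      intro x hx
      rw [mem_kids] at hx
      have hne : E.pp x ≠ E.ent h := by
        intro e
        have hxh : h ≠ x := fun e => hpar x hx.1 (hx.2.trans e)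
        have h1 := E.ok h x hh hx.1 hxh
        have h3 := E.side_ok x hx.1
        rw [hx.2] at h1 h3
        rw [entry_port (E.pp_lt h) (E.pp_lt x) (E.side_ok h hh) h3 e
          (fun e => hpar h hh (E.pos_inj e)) (fun e => hxh (E.pos_inj e).symm)] at h1
        exact absurd h1 (by simp)
      have h4 := E.pp_lt x
      revert hne h4 hent
      generalize E.pp x = a
      generalize E.ent h = b
      intro hb hne ha
      interval_cases a <;> interval_cases b <;> simp at hne ⊢)
  refine ⟨cs, h1, h2, ?_⟩
  rw [List.mem_sublistsLen]
  constructor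
  · rw [E.map_prt h2]
    have : freePorts (tab n Y) (E.opt h) =
        ([0, 1, 2, 3].eraseIdx (E.ent h)).map (thePort n Y (E.pos h)) := by
      change List.eraseIdx (nth [] (tab n Y) (E.pos h)) (E.ent h) = _
      rw [tab_row (E.pos_lt h), List.eraseIdx_map]
    rw [this]
    exact h3.map _
  · rw [List.length_map]
    have : cs.toFinset = kids par root h := by ext x; simp [h2]
    rw [← this, List.toFinset_card_of_nodup h1]

theorem full_bit {m b : Nat} (h : b < m) : (Nat.pred (Nat.pow 2 m)).testBit b = true := by
  change (2 ^ m - 1).testBit b = true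
  rw [Nat.testBit_two_pow_sub_one]; simpa using h

theorem initial (E : Emb V n Y par root) :
    E.Inv (Nat.pred (Nat.pow 2 (Nat.add (Nat.mul n n) 64))) (nincMask n (E.pos root))
      (fun x => x ≠ root) := by
  intro w hw
  refine ⟨hw, ?_, fun hp => E.ninc_cd (Ne.symm hw) (Ne.symm hp)⟩
  apply full_bit
  have h1 := E.fst_lt w
  have h2 := E.snd_lt w
  have h3 : fstE (E.pp w) (E.pos (par w)) (E.pos w) * n +
    sndE (E.pp w) (E.pos (par w)) (E.pos w) < n * n := by nlinarith
  exact Nat.add_lt_add_right h3 64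

/-- The vertices placed in the last stage. -/
def Res (par : V → V) (root x : V) : Prop :=
  x ≠ root ∧ ((par x = root ∧ (kids par root x).card = 0) ∨ (par x ≠ root ∧ par (par x) = root))

/-- The first level of the tree is correctly represented by the search. -/
def RaOk (E : Emb V n Y par root) (ra : List Port → List (List (Port × Nat) × List Port)) : Prop :=
  ∃ hs vs : List V, hs.Nodup ∧ vs.Nodup ∧
    (∀ x, x ∈ hs ↔ (x ∈ kids par root root ∧ (kids par root x).card ≠ 0)) ∧
    (∀ x, x ∈ vs ↔ (x ∈ kids par root root ∧ (kids par root x).card = 0)) ∧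
    (hs.map (fun v => (E.prt v, (kids par root v).card)), vs.map E.prt) ∈
      ra ([0, 1, 2, 3].map (thePort n Y (E.pos root)))

theorem core (E : Emb V n Y par root) (hpar : ∀ v, v ≠ root → par v ≠ v)
    (fin : List (List Port) → Nat → Nat → List Port → Bool)
    (ra : List Port → List (List (Port × Nat) × List Port)) (hra : E.RaOk ra)
    (hfin : ∀ cs : V → List V, (∀ h, h ≠ root → ((cs h).Nodup ∧
      (∀ x, x ∈ cs h ↔ x ∈ kids par root h) ∧
      (cs h).map E.prt ∈
        List.sublistsLen (kids par root h).card (freePorts (tab n Y) (E.opt h)))) →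
      ∀ res : List V, res.Nodup → (∀ x, x ∈ res ↔ Res par root x) →
      ∀ A NI, E.Inv A NI (fun x => x ≠ root ∧ ¬ (par x = root ∧ (kids par root x).card ≠ 0)) →
        fin (tab n Y) A NI (res.map E.prt) = false) :
    search n Y fin ra = false := by
  classical
  have hex : ∀ h, ∃ cs : List V, h ≠ root → (cs.Nodup ∧
      (∀ x, x ∈ cs ↔ x ∈ kids par root h) ∧
      cs.map E.prt ∈
        List.sublistsLen (kids par root h).card (freePorts (tab n Y) (E.opt h))) := by
    intro h
    by_cases hh : h = root
    · exact ⟨[], fun h' => absurd hh h'⟩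
    · obtain ⟨cs, hcs⟩ := E.exists_kids hpar h hh
      exact ⟨cs, fun _ => hcs⟩
  choose cs hcs using hex
  obtain ⟨hs, vs, hn, vn, hm, vm, hmem⟩ := hra
  unfold search
  rw [withTab_eq]
  apply lall_false (List.mem_range.2 (E.pos_lt root))
  rw [force_eq, force_eq]
  rw [tab_row (E.pos_lt root)]
  apply lall_false hmem
  have hsr : ∀ h ∈ hs, h ≠ root := fun h hh => (mem_kids.1 ((hm h).1 hh).1).1
  have hcol : ∀ x, x ∈ collect cs hs vs ↔ Res par root x := by
    intro x
    rw [mem_collect, vm, mem_kids]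
    constructor
    · rintro (⟨⟨h1, h2⟩, h3⟩ | ⟨h, hh, hx⟩)
      · exact ⟨h1, Or.inl ⟨h2, h3⟩⟩
      · have h1 := mem_kids.1 (((hcs h (hsr h hh)).2.1 x).1 hx)
        have h2 := mem_kids.1 ((hm h).1 hh).1
        refine ⟨h1.1, Or.inr ?_⟩
        rw [h1.2]
        exact h2
    · rintro ⟨h1, ⟨h2, h3⟩ | ⟨h2, h3⟩⟩
      · exact Or.inl ⟨⟨h1, h2⟩, h3⟩
      · have hk : x ∈ kids par root (par x) := mem_kids.2 ⟨h1, rfl⟩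
        refine Or.inr ⟨par x, (hm _).2 ⟨mem_kids.2 ⟨h2, h3⟩, ?_⟩, ((hcs _ h2).2.1 x).2 hk⟩
        exact Finset.card_ne_zero_of_mem hk
  have hnot : ∀ x, Res par root x → x ∉ hs := by
    rintro x ⟨h1, ⟨h2, h3⟩ | ⟨h2, h3⟩⟩ hx
    · exact ((hm x).1 hx).2 h3
    · exact h2 (mem_kids.1 ((hm x).1 hx).1).2
  apply E.hgo_false hpar (tab n Y) (fin (tab n Y)) cs (fun v => (kids par root v).card) hs vs _ _
    (fun x => x ≠ root) E.initial hn hsr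
  · exact fun h hh => (hcs h (hsr h hh)).2.2
  · intro x hx
    rw [hcol] at hx
    exact ⟨hx.1, hnot x hx⟩
  · intro A NI hI
    apply hfin cs hcs _ _ hcol
    · intro x hx
      have conv : ∀ x, (x ≠ root ∧ ¬ (par x = root ∧ (kids par root x).card ≠ 0)) →
          (x ≠ root ∧ x ∉ hs) := fun x hx => ⟨hx.1, fun h => hx.2
            ⟨(mem_kids.1 ((hm x).1 h).1).2, ((hm x).1 h).2⟩⟩
      obtain ⟨a, b, c⟩ := hI x (conv x hx)
      exact ⟨a, b, fun d => c (conv _ d)⟩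
    · apply nodup_collect (par := par) vn hn
      · exact fun h hh => (hcs h (hsr h hh)).1
      · exact fun h hh x hx => (mem_kids.1 (((hcs h (hsr h hh)).2.1 x).1 hx)).2
      · intro x hx h
        rw [(mem_kids.1 ((vm x).1 hx).1).2] at h
        exact hsr root h rfl

theorem core0 (E : Emb V n Y par root) (hpar : ∀ v, v ≠ root → par v ≠ v)
    (ra : List Port → List (List (Port × Nat) × List Port)) (hra : E.RaOk ra)
    (hres : ∀ x y, Res par root x → Res par root y → par y ≠ x) :
    search n Y (fun _ => fin0) ra = false := by
  apply E.core hpar _ _ hra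
  intro cs hcs res hn hm A NI hI
  apply E.lgo_false _ _ _ hn
  · intro v hv
    have h := (hm v).1 hv
    have h2 := hI v ⟨h.1, fun h' => by
      rcases h.2 with h3 | h3
      · exact h'.2 h3.2
      · exact h3.1 h'.1⟩
    exact ⟨h2.1, h2.2.1⟩
  · exact fun v hv w hw => hres v w ((hm v).1 hv) ((hm w).1 hw)

theorem core1 (E : Emb V n Y par root) (hpar : ∀ v, v ≠ root → par v ≠ v)
    (ra : List Port → List (List (Port × Nat) × List Port)) (hra : E.RaOk ra)
    (hres : ∀ x y, Res par root x → Res par root y → par y ≠ x)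
    (sp : V) (hsp : Res par root sp) (j : Nat) (hj : (kids par root sp).card = j)
    (hsr : ∀ x, par x = sp → ∀ y, Res par root y → par y ≠ x) :
    search n Y (fun T => fin1 T j) ra = false := by
  apply E.core hpar _ _ hra
  intro cs hcs res hn hm A NI hI
  have hW : ∀ v, Res par root v →
      v ≠ root ∧ ¬ (par v = root ∧ (kids par root v).card ≠ 0) := fun v h => ⟨h.1, fun h' => by
      rcases h.2 with h3 | h3
      · exact h'.2 h3.2
      · exact h3.1 h'.1⟩
  have hc := hcs sp hsp.1
  have hc2 : ∀ x ∈ cs sp, x ≠ root ∧ par x = sp := fun x hx => mem_kids.1 ((hc.2.1 x).1 hx)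
  apply E.fin1_false hpar (tab n Y) j A NI _ hI cs sp res ((hm sp).2 hsp) hn
  · exact fun v hv => hW v ((hm v).1 hv)
  · exact fun v hv w hw => hres v w ((hm v).1 hv) ((hm w).1 hw)
  · rw [← hj]; exact hc.2.2
  · exact hc.1
  · intro x hx
    refine ⟨(hc2 x hx).1, fun h => ?_⟩
    exact hsp.1 ((hc2 x hx).2.symm.trans h.1)
  · exact fun x hx => (hc2 x hx).2
  · exact fun x hx v hv => hsr x (hc2 x hx).2 v ((hm v).1 hv)

theorem ra17_ok (E : Emb V n Y par root) (h4 : (kids par root root).card = 4)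
    (h3 : ∀ x ∈ kids par root root, (kids par root x).card = 3) : E.RaOk ra17 := by
  obtain ⟨cs, h1, h2, hs⟩ := E.exists_root root
  have hl : cs.length = 4 := by
    rw [← h4, ← List.toFinset_card_of_nodup h1]
    congr 1; ext x; simp [h2]
  have he : cs.map E.pp = [0, 1, 2, 3] := hs.eq_of_length (by simp [hl])
  refine ⟨cs, [], h1, List.nodup_nil, fun x => ?_, fun x => ?_, ?_⟩
  · rw [h2]
    exact ⟨fun h => ⟨h, by rw [h3 x h]; decide⟩, fun h => h.1⟩
  · constructor
    · intro h; simp at h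
    · intro h; have := h3 x h.1; omega
  · rw [← he, ← E.map_prt h2]
    unfold ra17
    rw [List.mem_singleton, List.map_map]
    congr 1
    apply List.map_congr_left
    intro x hx
    simp only [Function.comp, h3 x ((h2 x).1 hx)]

theorem ra13_ok (E : Emb V n Y par root) (h4 : (kids par root root).card = 3)
    (h3 : ∀ x ∈ kids par root root, (kids par root x).card = 3) : E.RaOk ra13 := by
  obtain ⟨cs, h1, h2, hs⟩ := E.exists_root root
  have hl : cs.length = 3 := by
    rw [← h4, ← List.toFinset_card_of_nodup h1]
    congr 1; ext x; simp [h2]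
  refine ⟨cs, [], h1, List.nodup_nil, fun x => ?_, fun x => ?_, ?_⟩
  · rw [h2]
    exact ⟨fun h => ⟨h, by rw [h3 x h]; decide⟩, fun h => h.1⟩
  · constructor
    · intro h; simp at h
    · intro h; have := h3 x h.1; omega
  · unfold ra13
    rw [List.mem_map]
    refine ⟨cs.map E.prt, ?_, ?_⟩
    · rw [List.mem_sublistsLen, E.map_prt h2]
      exact ⟨hs.map _, by simp [hl]⟩
    · rw [List.map_map]
      congr 1
      apply List.map_congr_left
      intro x hx
      simp only [Function.comp, h3 x ((h2 x).1 hx)]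

theorem root_split (E : Emb V n Y par root) (h4 : (kids par root root).card = 4) (z : V)
    (hz : z ∈ kids par root root) :
    ∃ l₁ l₂ : List V, (l₁ ++ z :: l₂).Nodup ∧ (∀ x, x ∈ l₁ ++ z :: l₂ ↔ x ∈ kids par root root) ∧
      (E.prt z, (l₁ ++ l₂).map E.prt) ∈ splits ([0, 1, 2, 3].map (thePort n Y (E.pos root))) := by
  obtain ⟨cs, h1, h2, hs⟩ := E.exists_root root
  have hl : cs.length = 4 := by
    rw [← h4, ← List.toFinset_card_of_nodup h1]
    congr 1; ext x; simp [h2]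
  have he : cs.map E.pp = [0, 1, 2, 3] := hs.eq_of_length (by simp [hl])
  obtain ⟨l₁, l₂, rfl⟩ := List.append_of_mem ((h2 z).2 hz)
  refine ⟨l₁, l₂, h1, h2, ?_⟩
  rw [← he, ← E.map_prt h2, List.map_append, List.map_append, List.map_cons]
  exact mem_splits _ _ _

theorem ra14_ok (E : Emb V n Y par root) (h4 : (kids par root root).card = 4) (z : V)
    (hz : z ∈ kids par root root) (hz0 : (kids par root z).card = 0)
    (h3 : ∀ x ∈ kids par root root, x ≠ z → (kids par root x).card = 3) : E.RaOk ra14 := by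
  obtain ⟨l₁, l₂, hn, hm, hs⟩ := E.root_split h4 z hz
  have hn2 : (z :: (l₁ ++ l₂)).Nodup := (List.perm_middle.nodup_iff).1 hn
  rw [List.nodup_cons] at hn2
  have hm2 : ∀ x, x ∈ kids par root root ↔ x = z ∨ x ∈ l₁ ++ l₂ := by
    intro x; rw [← hm, List.perm_middle.mem_iff, List.mem_cons]
  have h3' : ∀ x ∈ l₁ ++ l₂, (kids par root x).card = 3 := fun x hx =>
    h3 x ((hm2 x).2 (Or.inr hx)) (fun e => hn2.1 (e ▸ hx))
  refine ⟨l₁ ++ l₂, [z], hn2.2, by simp, fun x => ?_, fun x => ?_, ?_⟩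
  · rw [hm2]
    constructor
    · intro h; exact ⟨Or.inr h, by rw [h3' x h]; decide⟩
    · rintro ⟨rfl | h, h'⟩
      · exact absurd hz0 h'
      · exact h
  · rw [hm2, List.mem_singleton]
    constructor
    · rintro rfl; exact ⟨Or.inl rfl, hz0⟩
    · rintro ⟨rfl | h, h'⟩
      · rfl
      · rw [h3' x h] at h'; omega
  · unfold ra14
    rw [List.mem_map]
    refine ⟨_, hs, ?_⟩
    rw [List.map_map]
    congr 1
    apply List.map_congr_left
    intro x hx
    simp only [Function.comp, h3' x hx]

theorem ra16_ok (E : Emb V n Y par root) (h4 : (kids par root root).card = 4) (z : V)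
    (hz : z ∈ kids par root root) (hz0 : (kids par root z).card = 2)
    (h3 : ∀ x ∈ kids par root root, x ≠ z → (kids par root x).card = 3) : E.RaOk ra16 := by
  obtain ⟨l₁, l₂, hn, hm, hs⟩ := E.root_split h4 z hz
  have hn2 : (z :: (l₁ ++ l₂)).Nodup := (List.perm_middle.nodup_iff).1 hn
  have hn3 : (l₁ ++ l₂ ++ [z]).Nodup :=
    ((List.perm_append_singleton z (l₁ ++ l₂)).nodup_iff).2 hn2
  rw [List.nodup_cons] at hn2
  have hm2 : ∀ x, x ∈ kids par root root ↔ x = z ∨ x ∈ l₁ ++ l₂ := by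
    intro x; rw [← hm, List.perm_middle.mem_iff, List.mem_cons]
  have h3' : ∀ x ∈ l₁ ++ l₂, (kids par root x).card = 3 := fun x hx =>
    h3 x ((hm2 x).2 (Or.inr hx)) (fun e => hn2.1 (e ▸ hx))
  have hne : ∀ x ∈ kids par root root, (kids par root x).card ≠ 0 := by
    intro x hx
    rcases (hm2 x).1 hx with rfl | h
    · rw [hz0]; decide
    · rw [h3' x h]; decide
  refine ⟨l₁ ++ l₂ ++ [z], [], hn3, List.nodup_nil, fun x => ?_, fun x => ?_, ?_⟩
  · rw [List.mem_append, List.mem_singleton]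
    constructor
    · intro h
      have : x ∈ kids par root root := (hm2 x).2 h.symm
      exact ⟨this, hne x this⟩
    · intro h
      exact ((hm2 x).1 h.1).symm
  · constructor
    · intro h; simp at h
    · intro h; exact absurd h.2 (hne x h.1)
  · unfold ra16
    rw [List.mem_map]
    refine ⟨_, hs, ?_⟩
    rw [List.map_map, List.map_append (l₂ := [z]), List.map_cons, List.map_nil, hz0]
    congr 2
    apply List.map_congr_left
    intro x hx
    simp only [Function.comp, h3' x hx]

end Emb


/-! ### From drawings in the plane to abstract drawings -/

/-- The point with `x`-coordinate `p`. -/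
noncomputable def pt (Y p : Nat) : ℝ × ℝ := ((p : ℝ), (yc Y p : ℝ))

/-- The point set. -/
noncomputable def pts (n Y : Nat) : Finset (ℝ × ℝ) := (Finset.range n).image (pt Y)

theorem pt_inj (Y : Nat) : Function.Injective (pt Y) := by
  intro p q h
  have := congrArg Prod.fst h
  simpa [pt] using this

theorem pts_card (n Y : Nat) : (pts n Y).card = n := by
  rw [pts, Finset.card_image_of_injective _ (pt_inj Y), Finset.card_range]

theorem pts_isPointSet {n Y : Nat} (hY : ∀ p < n, ∀ q < n, yc Y p = yc Y q → p = q) :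
    IsPointSet (pts n Y) := by
  intro a ha b hb hab
  obtain ⟨p, hp, rfl⟩ := Finset.mem_image.1 ha
  obtain ⟨q, hq, rfl⟩ := Finset.mem_image.1 hb
  rw [Finset.mem_range] at hp hq
  have hpq : p ≠ q := fun h => hab (h ▸ rfl)
  constructor
  · simpa [pt] using hpq
  · simp only [pt, ne_eq, Nat.cast_inj]
    exact fun h => hpq (hY p hp q hq h)

/-- The tree given by a parent function. -/
def treeG {n : Nat} (par : Fin n → Fin n) (r : Fin n) : SimpleGraph (Fin n) where
  Adj u v := u ≠ v ∧ ((u ≠ r ∧ par u = v) ∨ (v ≠ r ∧ par v = u))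
  symm := ⟨fun u v h => ⟨h.1.symm, h.2.symm⟩⟩
  loopless := ⟨fun u h => h.1 rfl⟩

theorem mem_horiz {a b t : Nat} (y : ℝ) (h : (a ≤ t ∧ t ≤ b) ∨ (b ≤ t ∧ t ≤ a)) :
    ((t : ℝ), y) ∈ segment ℝ ((a : ℝ), y) ((b : ℝ), y) := by
  rw [← Prod.image_mk_segment_left, segment_eq_uIcc]
  refine ⟨(t : ℝ), ?_, rfl⟩
  rw [Set.mem_uIcc]
  exact_mod_cast h

theorem mem_vert {a b t : Nat} (x : ℝ) (h : (a ≤ t ∧ t ≤ b) ∨ (b ≤ t ∧ t ≤ a)) :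
    (x, (t : ℝ)) ∈ segment ℝ (x, (a : ℝ)) (x, (b : ℝ)) := by
  rw [← Prod.image_mk_segment_right, segment_eq_uIcc]
  refine ⟨(t : ℝ), ?_, rfl⟩
  rw [Set.mem_uIcc]
  exact_mod_cast h

section

variable {n Y : Nat} {φ : Fin n → ℝ × ℝ} {c : Fin n → Fin n → ℝ × ℝ}

/-- The edge `uv` is drawn as the L `(p, q)`. -/
def DrawP (Y : Nat) (φ : Fin n → ℝ × ℝ) (c : Fin n → Fin n → ℝ × ℝ) (u v : Fin n) (p q : Nat) :
    Prop :=
  c u v = ((q : ℝ), (yc Y p : ℝ)) ∧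
    ((φ u = pt Y p ∧ φ v = pt Y q) ∨ (φ u = pt Y q ∧ φ v = pt Y p))

theorem DrawP.horiz {u v : Fin n} {p q t : Nat} (h : DrawP Y φ c u v p q)
    (ht : (p ≤ t ∧ t ≤ q) ∨ (q ≤ t ∧ t ≤ p)) : ((t : ℝ), (yc Y p : ℝ)) ∈ LDraw φ c u v := by
  unfold LDraw
  rw [h.1]
  rcases h.2 with ⟨h1, _⟩ | ⟨_, h1⟩
  · left
    rw [h1]; exact mem_horiz _ ht
  · right
    rw [h1]; exact mem_horiz _ ht.symm

theorem DrawP.vert {u v : Fin n} {p q t : Nat} (h : DrawP Y φ c u v p q)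
    (ht : (yc Y p ≤ t ∧ t ≤ yc Y q) ∨ (yc Y q ≤ t ∧ t ≤ yc Y p)) :
    ((q : ℝ), (t : ℝ)) ∈ LDraw φ c u v := by
  unfold LDraw
  rw [h.1]
  rcases h.2 with ⟨_, h1⟩ | ⟨h1, _⟩
  · right
    rw [h1]; exact mem_vert _ ht
  · left
    rw [h1]; exact mem_vert _ ht.symm

theorem no_hit {G : SimpleGraph (Fin n)} (hY : ∀ p < n, ∀ q < n, yc Y p = yc Y q → p = q)
    (hE : IsLEmbedding G (pts n Y) φ c) {u v a b : Fin n} (huv : G.Adj u v) (hab : G.Adj a b)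
    (hne : s(u, v) ≠ s(a, b)) {p q r s : Nat} (hp : p < n)
    (h1 : DrawP Y φ c u v p q) (h2 : DrawP Y φ c a b r s) : hit Y p q r s = false := by
  rw [Bool.eq_false_iff, Ne, hit_iff]
  rintro ⟨hsp, hb1, hb2⟩
  obtain ⟨w, _, _, hw⟩ := hE.2.2.2.2 u v a b huv hab hne ((s : ℝ), (yc Y p : ℝ))
    ⟨h1.horiz hb1, h2.vert hb2⟩
  obtain ⟨k, hk, hk2⟩ := Finset.mem_image.1 (hE.2.1 w)
  rw [← hk2] at hw
  have e1 := congrArg Prod.fst hw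
  have e2 := congrArg Prod.snd hw
  simp only [pt, Nat.cast_inj] at e1 e2
  have := hY p hp k (Finset.mem_range.1 hk) e2
  omega

theorem exists_emb {par : Fin n → Fin n} {r : Fin n} (hpar : ∀ v, v ≠ r → par v < v)
    (hY : ∀ p < n, ∀ q < n, yc Y p = yc Y q → p = q)
    (h : HasLEmbedding (treeG par r) (pts n Y)) : Nonempty (Emb (Fin n) n Y par r) := by
  classical
  obtain ⟨φ, c, hE⟩ := h
  have hpos : ∀ v, ∃ p, p < n ∧ φ v = pt Y p := by
    intro v
    obtain ⟨k, hk, hk2⟩ := Finset.mem_image.1 (hE.2.1 v)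
    exact ⟨k, Finset.mem_range.1 hk, hk2.symm⟩
  choose pos hlt hφ using hpos
  have hinj : Function.Injective pos := by
    intro u v e
    apply hE.1
    rw [hφ, hφ, e]
  have hadj : ∀ v, v ≠ r → (treeG par r).Adj v (par v) := fun v hv =>
    ⟨(hpar v hv).ne', Or.inl ⟨hv, rfl⟩⟩
  have hpp : ∀ v, ∃ d, d < 4 ∧ (v ≠ r → side Y d (pos (par v)) (pos v) = true ∧
      DrawP Y φ c v (par v) (fstE d (pos (par v)) (pos v)) (sndE d (pos (par v)) (pos v))) := by
    intro v
    by_cases hv : v = r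
    · exact ⟨0, by decide, fun h => absurd hv h⟩
    have hne : pos (par v) ≠ pos v := fun e => (hpar v hv).ne (hinj e)
    have hyne : yc Y (pos (par v)) ≠ yc Y (pos v) := fun e => hne (hY _ (hlt _) _ (hlt _) e)
    rcases hE.2.2.2.1 v (par v) (hadj v hv) with hc | hc
    · have hD : DrawP Y φ c v (par v) (pos (par v)) (pos v) := by
        refine ⟨?_, Or.inr ⟨hφ _, hφ _⟩⟩
        rw [hc, hφ v, hφ (par v)]; rfl
      rcases lt_or_gt_of_ne hne with h | h
      · exact ⟨0, by decide, fun _ => ⟨(side_iff (by decide)).2 (by omega), hD⟩⟩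
      · exact ⟨1, by decide, fun _ => ⟨(side_iff (by decide)).2 (by omega), hD⟩⟩
    · have hD : DrawP Y φ c v (par v) (pos v) (pos (par v)) := by
        refine ⟨?_, Or.inl ⟨hφ _, hφ _⟩⟩
        rw [hc, hφ v, hφ (par v)]; rfl
      rcases lt_or_gt_of_ne hyne with h | h
      · exact ⟨2, by decide, fun _ => ⟨(side_iff (by decide)).2 (by omega), hD⟩⟩
      · exact ⟨3, by decide, fun _ => ⟨(side_iff (by decide)).2 (by omega), hD⟩⟩
  choose pp hpp4 hpp2 using hpp
  have hF : ∀ v, fstE (pp v) (pos (par v)) (pos v) < n := by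
    intro v
    unfold fstE
    cases Nat.blt (pp v) 2
    · exact hlt _
    · exact hlt _
  refine ⟨⟨pos, pp, hlt, hinj, hpp4, fun v hv => (hpp2 v hv).1, ?_⟩⟩
  intro v w hv hw hvw
  have hne : s(v, par v) ≠ s(w, par w) := by
    intro e
    rw [Sym2.eq_iff] at e
    rcases e with e | e
    · exact hvw e.1
    · have h1 := hpar v hv
      have h2 := hpar w hw
      rw [e.2] at h1
      rw [← e.1] at h2
      exact absurd h1 (not_lt.2 h2.le)
  unfold okc
  rw [no_hit hY hE (hadj v hv) (hadj w hw) hne (hF v) (hpp2 v hv).2 (hpp2 w hw).2,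
    no_hit hY hE (hadj w hw) (hadj v hv) hne.symm (hF w) (hpp2 w hw).2 (hpp2 v hv).2]
  rfl

end

theorem treeG_isTree {n : Nat} {par : Fin n → Fin n} {r : Fin n}
    (hpar : ∀ v, v ≠ r → par v < v) : (treeG par r).IsTree := by
  classical
  have hadj : ∀ v, v ≠ r → (treeG par r).Adj v (par v) := fun v hv =>
    ⟨(hpar v hv).ne', Or.inl ⟨hv, rfl⟩⟩
  rw [SimpleGraph.isTree_iff_connected_and_card]
  constructor
  · have hr : ∀ v, (treeG par r).Reachable v r := by
      intro v
      induction v using WellFoundedLT.induction with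
      | ind v ih =>
        by_cases hv : v = r
        · rw [hv]
        · exact (hadj v hv).reachable.trans (ih _ (hpar v hv))
    haveI : Nonempty (Fin n) := ⟨r⟩
    exact ⟨fun u v => (hr u).trans (hr v).symm⟩
  · have he : (treeG par r).edgeSet = (fun v => s(v, par v)) '' {v | v ≠ r} := by
      ext e
      induction e using Sym2.ind with
      | _ u v =>
        rw [SimpleGraph.mem_edgeSet]
        constructor
        · rintro ⟨_, ⟨h1, h2⟩ | ⟨h1, h2⟩⟩
          · exact ⟨u, h1, by rw [← h2]⟩
          · exact ⟨v, h1, by simp only [h2]; exact Sym2.eq_swap⟩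
        · rintro ⟨w, hw, e⟩
          have := hadj w hw
          rw [← SimpleGraph.mem_edgeSet] at this ⊢
          rw [← e]; exact this
    have hinj : Set.InjOn (fun v => s(v, par v)) {v | v ≠ r} := by
      intro v hv w hw e
      simp only [Sym2.eq_iff] at e
      rcases e with e | e
      · exact e.1
      · have h1 := hpar v hv
        have h2 := hpar w hw
        rw [e.2] at h1
        rw [← e.1] at h2
        exact absurd h1 (not_lt.2 h2.le)
    rw [Nat.card_coe_set_eq, he, Set.InjOn.ncard_image hinj]
    have : ({v | v ≠ r} : Set (Fin n)) = ((Finset.univ.erase r : Finset (Fin n)) : Set (Fin n)) := by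
      ext x; simp
    rw [this, Set.ncard_coe_finset, Finset.card_erase_of_mem (Finset.mem_univ r)]
    have h0 : 0 < n := r.pos
    simp
    omega

/-- Neighbours, as a finset. -/
def nbrs {n : Nat} (par : Fin n → Fin n) (r v : Fin n) : Finset (Fin n) :=
  Finset.univ.filter fun u => v ≠ u ∧ ((v ≠ r ∧ par v = u) ∨ (u ≠ r ∧ par u = v))

theorem ncard_nbrs {n : Nat} (par : Fin n → Fin n) (r v : Fin n) :
    ((treeG par r).neighborSet v).ncard = (nbrs par r v).card := by
  rw [← Set.ncard_coe_finset]
  congr 1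
  ext u
  simp [nbrs, treeG]

theorem assemble {n Y : Nat} (par : Fin n → Fin n) (r : Fin n)
    (hpar : ∀ v, v ≠ r → par v < v)
    (hY : ∀ p < n, ∀ q < n, yc Y p = yc Y q → p = q)
    (hd : ∀ v, (nbrs par r v).card ≤ 4) (hd' : ∃ v, (nbrs par r v).card = 4)
    (hno : (∀ v, v ≠ r → par v ≠ v) → Emb (Fin n) n Y par r → False) :
    ∃ G : SimpleGraph (Fin n), G.IsTree ∧
      (∀ v, (G.neighborSet v).ncard ≤ 4) ∧ (∃ v, (G.neighborSet v).ncard = 4) ∧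
      ∃ S : Finset (ℝ × ℝ), IsPointSet S ∧ S.card = n ∧ ¬ HasLEmbedding G S := by
  refine ⟨treeG par r, treeG_isTree hpar, ?_, ?_, pts n Y, pts_isPointSet hY, pts_card n Y, ?_⟩
  · intro v; rw [ncard_nbrs]; exact hd v
  · obtain ⟨v, hv⟩ := hd'
    exact ⟨v, by rw [ncard_nbrs]; exact hv⟩
  · intro h
    obtain ⟨E⟩ := exists_emb hpar hY h
    exact hno (fun v hv => (hpar v hv).ne) E

theorem run13 : search 13 Y13 (fun _ => fin0) ra13 = true := by decide +kernel
theorem run14 : search 14 Y14 (fun _ => fin0) ra14 = true := by decide +kernel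
theorem run16 : search 16 Y16 (fun _ => fin0) ra16 = true := by decide +kernel
theorem run17 : search 17 Y17 (fun _ => fin0) ra17 = true := by decide +kernel
theorem run18 : search 18 Y18 (fun T => fin1 T 1) ra17 = true := by decide +kernel
theorem run19 : search 19 Y19 (fun T => fin1 T 2) ra17 = true := by decide +kernel
theorem run20 : search 20 Y20 (fun T => fin1 T 3) ra17 = true := by decide +kernel


/-! ### The trees -/

instance {V : Type} [Fintype V] [DecidableEq V] (par : V → V) (root x : V) :
    Decidable (Emb.Res par root x) := by
  unfold Emb.Res; infer_instance

/-- Parents in the tree for `n = 13`, as natural numbers. -/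
def parN13 (v : Nat) : Nat := if v ≤ 3 then 0 else (v - 4) / 3 + 1

/-- Parents in the trees for `n ≥ 14`, as natural numbers. -/
def parN (v : Nat) : Nat := if v ≤ 4 then 0 else if v ≤ 16 then (v - 5) / 3 + 1 else 5

theorem parN13_le (v : Nat) : parN13 v ≤ v := by unfold parN13; split <;> omega

theorem parN_le (v : Nat) : parN v ≤ v := by unfold parN; split_ifs <;> omega

/-- The parent map of the tree for `n = 13`. -/
def par13 (v : Fin 13) : Fin 13 := ⟨parN13 v, (parN13_le v).trans_lt v.2⟩

/-- The parent map of the tree for `n ≥ 14`. -/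
def parF {n : Nat} (v : Fin n) : Fin n := ⟨parN v, (parN_le v).trans_lt v.2⟩

theorem case13 : ∃ G : SimpleGraph (Fin 13), G.IsTree ∧
    (∀ v, (G.neighborSet v).ncard ≤ 4) ∧ (∃ v, (G.neighborSet v).ncard = 4) ∧
    ∃ S : Finset (ℝ × ℝ), IsPointSet S ∧ S.card = 13 ∧ ¬ HasLEmbedding G S := by
  refine assemble (Y := Y13) par13 0 (by decide +kernel) (by decide +kernel)
    (by decide +kernel) (by decide +kernel) fun hp E => ?_
  have h := E.core0 hp ra13 (E.ra13_ok (by decide +kernel) (by decide +kernel)) (by decide +kernel)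
  rw [run13] at h
  exact Bool.noConfusion h

theorem case14 : ∃ G : SimpleGraph (Fin 14), G.IsTree ∧
    (∀ v, (G.neighborSet v).ncard ≤ 4) ∧ (∃ v, (G.neighborSet v).ncard = 4) ∧
    ∃ S : Finset (ℝ × ℝ), IsPointSet S ∧ S.card = 14 ∧ ¬ HasLEmbedding G S := by
  refine assemble (Y := Y14) (parF (n := 14)) 0 (by decide +kernel) (by decide +kernel)
    (by decide +kernel) (by decide +kernel) fun hp E => ?_
  have h := E.core0 hp ra14 (E.ra14_ok (by decide +kernel) 4 (by decide +kernel) (by decide +kernel) (by decide +kernel)) (by decide +kernel)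
  rw [run14] at h
  exact Bool.noConfusion h

theorem case16 : ∃ G : SimpleGraph (Fin 16), G.IsTree ∧
    (∀ v, (G.neighborSet v).ncard ≤ 4) ∧ (∃ v, (G.neighborSet v).ncard = 4) ∧
    ∃ S : Finset (ℝ × ℝ), IsPointSet S ∧ S.card = 16 ∧ ¬ HasLEmbedding G S := by
  refine assemble (Y := Y16) (parF (n := 16)) 0 (by decide +kernel) (by decide +kernel)
    (by decide +kernel) (by decide +kernel) fun hp E => ?_
  have h := E.core0 hp ra16 (E.ra16_ok (by decide +kernel) 4 (by decide +kernel) (by decide +kernel) (by decide +kernel)) (by decide +kernel)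
  rw [run16] at h
  exact Bool.noConfusion h

theorem case17 : ∃ G : SimpleGraph (Fin 17), G.IsTree ∧
    (∀ v, (G.neighborSet v).ncard ≤ 4) ∧ (∃ v, (G.neighborSet v).ncard = 4) ∧
    ∃ S : Finset (ℝ × ℝ), IsPointSet S ∧ S.card = 17 ∧ ¬ HasLEmbedding G S := by
  refine assemble (Y := Y17) (parF (n := 17)) 0 (by decide +kernel) (by decide +kernel)
    (by decide +kernel) (by decide +kernel) fun hp E => ?_
  have h := E.core0 hp ra17 (E.ra17_ok (by decide +kernel) (by decide +kernel)) (by decide +kernel)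
  rw [run17] at h
  exact Bool.noConfusion h

theorem case18 : ∃ G : SimpleGraph (Fin 18), G.IsTree ∧
    (∀ v, (G.neighborSet v).ncard ≤ 4) ∧ (∃ v, (G.neighborSet v).ncard = 4) ∧
    ∃ S : Finset (ℝ × ℝ), IsPointSet S ∧ S.card = 18 ∧ ¬ HasLEmbedding G S := by
  refine assemble (Y := Y18) (parF (n := 18)) 0 (by decide +kernel) (by decide +kernel)
    (by decide +kernel) (by decide +kernel) fun hp E => ?_
  have h := E.core1 hp ra17 (E.ra17_ok (by decide +kernel) (by decide +kernel))
    (by decide +kernel) 5 (by decide +kernel) 1 (by decide +kernel) (by decide +kernel)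
  rw [run18] at h
  exact Bool.noConfusion h

theorem case19 : ∃ G : SimpleGraph (Fin 19), G.IsTree ∧
    (∀ v, (G.neighborSet v).ncard ≤ 4) ∧ (∃ v, (G.neighborSet v).ncard = 4) ∧
    ∃ S : Finset (ℝ × ℝ), IsPointSet S ∧ S.card = 19 ∧ ¬ HasLEmbedding G S := by
  refine assemble (Y := Y19) (parF (n := 19)) 0 (by decide +kernel) (by decide +kernel)
    (by decide +kernel) (by decide +kernel) fun hp E => ?_
  have h := E.core1 hp ra17 (E.ra17_ok (by decide +kernel) (by decide +kernel))
    (by decide +kernel) 5 (by decide +kernel) 2 (by decide +kernel) (by decide +kernel)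
  rw [run19] at h
  exact Bool.noConfusion h

theorem case20 : ∃ G : SimpleGraph (Fin 20), G.IsTree ∧
    (∀ v, (G.neighborSet v).ncard ≤ 4) ∧ (∃ v, (G.neighborSet v).ncard = 4) ∧
    ∃ S : Finset (ℝ × ℝ), IsPointSet S ∧ S.card = 20 ∧ ¬ HasLEmbedding G S := by
  refine assemble (Y := Y20) (parF (n := 20)) 0 (by decide +kernel) (by decide +kernel)
    (by decide +kernel) (by decide +kernel) fun hp E => ?_
  have h := E.core1 hp ra17 (E.ra17_ok (by decide +kernel) (by decide +kernel))
    (by decide +kernel) 5 (by decide +kernel) 3 (by decide +kernel) (by decide +kernel)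
  rw [run20] at h
  exact Bool.noConfusion h

end LShape

/-- For every `n ∈ {13, 14, 16, 17, 18, 19, 20}` there are an `n`-vertex tree with
maximum degree 4 and a point set of `n` points such that the tree does not admit an
L-shaped embedding in the point set. -/
theorem exists_nonembeddable_tree (n : ℕ)
    (hn : n ∈ ({13, 14, 16, 17, 18, 19, 20} : Finset ℕ)) :
    ∃ G : SimpleGraph (Fin n), G.IsTree ∧
      (∀ v, (G.neighborSet v).ncard ≤ 4) ∧ (∃ v, (G.neighborSet v).ncard = 4) ∧
      ∃ S : Finset (ℝ × ℝ), IsPointSet S ∧ S.card = n ∧ ¬ HasLEmbedding G S := by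
  simp only [Finset.mem_insert, Finset.mem_singleton] at hn
  rcases hn with rfl | rfl | rfl | rfl | rfl | rfl | rfl
  · exact LShape.case13
  · exact LShape.case14
  · exact LShape.case16
  · exact LShape.case17
  · exact LShape.case18
  · exact LShape.case19
  · exact LShape.case20
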